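/- There exist constants C, c > 0 depending only on a and μ such that for every integer q ≥ 3 with gcd(q, a) = 1 and every integer n > C·log q·log log q: q·‖μ_n mod q − u_q‖₂² ≤ e^{−c·n/log q}. -/

import Mathlib

open scoped Classical

/-- One step of the process: the law of `b + a·Y` where `b ~ μ` and `Y ~ f` are independent,
i.e. `μ * (m_a)_* f`. -/
noncomputable def step (a : ℤ) (μ f : ℤ → ℝ) : ℤ → ℝ :=
  fun x => ∑' y : ℤ, μ (x - a * y) * f y

/-- `walk a μ n` is the law `μ_n` of `X_n`, where `X_0 = 0` and `X_{n+1} = a·X_n + b_{n+1}`. -/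
noncomputable def walk (a : ℤ) (μ : ℤ → ℝ) : ℕ → ℤ → ℝ
  | 0 => fun x => if x = 0 then 1 else 0
  | n + 1 => step a μ (walk a μ n)

/-- Reduction of a measure on `ℤ` modulo `q` (pushforward to `ZMod q`). -/
noncomputable def modq (q : ℕ) (f : ℤ → ℝ) : ZMod q → ℝ :=
  fun x => ∑' y : ℤ, if (y : ZMod q) = x then f y else 0

/-- The ℓ¹ distance `‖f mod q − u_q‖` from the reduction of `f` to the uniform measure. -/
noncomputable def distUnif (q : ℕ) (f : ℤ → ℝ) : ℝ :=
  ∑' x : ZMod q, |modq q f x - 1 / q|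

/-- Entropy of a measure on `ℤ`. -/
noncomputable def entropy (f : ℤ → ℝ) : ℝ :=
  -∑' x : ℤ, f x * Real.log (f x)

/-- `μ` is a finitely supported probability measure on `ℤ` with
`gcd(supp μ − supp μ) = 1`. -/
structure IsGoodMeasure (μ : ℤ → ℝ) : Prop where
  nonneg : ∀ x, 0 ≤ μ x
  finsupp : (Function.support μ).Finite
  total : (∑' x, μ x) = 1
  gcd_one : ∀ d : ℤ, (∀ x ∈ Function.support μ, ∀ y ∈ Function.support μ, d ∣ x - y) → IsUnit d

/-! ### Fourier transforms on `ℤ` and on `ZMod q` -/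

/-- The Fourier transform at the angle `θ` of a function on `ℤ`. -/
noncomputable def fourierInt (f : ℤ → ℝ) (θ : ℝ) : ℂ :=
  ∑' y : ℤ, (f y : ℂ) * Complex.exp (2 * Real.pi * Complex.I * y * θ)

/-- The Fourier transform of a real function on `ZMod q`. -/
noncomputable def fourierZMod {q : ℕ} [NeZero q] (g : ZMod q → ℝ) (ξ : ZMod q) : ℂ :=
  ∑ x, (g x : ℂ) * ZMod.stdAddChar (x * ξ)

theorem fourierInt_eq_sum {f : ℤ → ℝ} {T : Finset ℤ} (hT : Function.support f ⊆ T) (θ : ℝ) :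
    fourierInt f θ = ∑ y ∈ T, (f y : ℂ) * Complex.exp (2 * Real.pi * Complex.I * y * θ) := by
  refine tsum_eq_sum fun y hy => ?_
  have : f y = 0 := by
    by_contra h
    exact hy (hT h)
  simp [this]

theorem modq_eq_sum {f : ℤ → ℝ} {T : Finset ℤ} (hT : Function.support f ⊆ T) (q : ℕ)
    (x : ZMod q) : modq q f x = ∑ y ∈ T, if (y : ZMod q) = x then f y else 0 := by
  refine tsum_eq_sum fun y hy => ?_
  have : f y = 0 := by
    by_contra h
    exact hy (hT h)
  simp [this]

theorem support_step_finite {a : ℤ} {μ f : ℤ → ℝ} (hμ : (Function.support μ).Finite)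
    (hf : (Function.support f).Finite) : (Function.support (step a μ f)).Finite := by
  refine ((hμ.prod hf).image fun p : ℤ × ℤ => p.1 + a * p.2).subset fun x hx => ?_
  obtain ⟨y, hy⟩ : ∃ y, μ (x - a * y) * f y ≠ 0 := by
    by_contra! h
    exact hx (by simp [step, h])
  exact ⟨(x - a * y, y), ⟨left_ne_zero_of_mul hy, right_ne_zero_of_mul hy⟩, by simp⟩

theorem support_walk_finite {a : ℤ} {μ : ℤ → ℝ} (hμ : (Function.support μ).Finite) (n : ℕ) :
    (Function.support (walk a μ n)).Finite := by
  induction n with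
  | zero =>
    refine (Set.finite_singleton (0 : ℤ)).subset fun x hx => ?_
    by_contra h
    exact hx (if_neg h)
  | succ n ih => exact support_step_finite hμ ih

theorem fourierInt_step {a : ℤ} {μ f : ℤ → ℝ} (hμ : (Function.support μ).Finite)
    (hf : (Function.support f).Finite) (θ : ℝ) :
    fourierInt (step a μ f) θ = fourierInt μ θ * fourierInt f (a * θ) := by
  obtain ⟨T, hT⟩ : ∃ T : Finset ℤ, Function.support f ⊆ T := ⟨hf.toFinset, by simp⟩
  have hstep (x : ℤ) : step a μ f x = ∑ y ∈ T, μ (x - a * y) * f y := by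
    refine tsum_eq_sum fun y hy => ?_
    have : f y = 0 := by
      by_contra h
      exact hy (hT h)
    simp [this]
  have hsum (y : ℤ) : Summable fun x : ℤ => ((μ (x - a * y) : ℂ) * f y) *
      Complex.exp (2 * Real.pi * Complex.I * x * θ) := by
    refine summable_of_hasFiniteSupport ((hμ.image fun x => x + a * y).subset fun x hx => ?_)
    have h := left_ne_zero_of_mul (left_ne_zero_of_mul hx)
    exact ⟨x - a * y, by simpa using h, by simp⟩
  rw [fourierInt_eq_sum hT, fourierInt, Finset.mul_sum]
  simp only [hstep, Complex.ofReal_sum, Complex.ofReal_mul, Finset.sum_mul]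
  rw [Summable.tsum_finsetSum fun y _ => hsum y]
  refine Finset.sum_congr rfl fun y _ => ?_
  rw [← (Equiv.addRight (a * y)).tsum_eq, fourierInt, ← tsum_mul_right]
  refine tsum_congr fun x => ?_
  simp only [Equiv.coe_addRight, add_sub_cancel_right]
  have : Complex.exp (2 * Real.pi * Complex.I * ((x + a * y : ℤ) : ℂ) * θ) =
      Complex.exp (2 * Real.pi * Complex.I * x * θ) *
        Complex.exp (2 * Real.pi * Complex.I * y * ((a * θ : ℝ) : ℂ)) := by
    rw [← Complex.exp_add]
    congr 1
    push_cast
    ring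
  rw [this, Complex.ofReal_mul]
  ring

theorem fourierInt_walk_zero (a : ℤ) (μ : ℤ → ℝ) (θ : ℝ) : fourierInt (walk a μ 0) θ = 1 := by
  have h : Function.support (walk a μ 0) ⊆ ({0} : Finset ℤ) := fun x hx => by
    by_contra h
    exact hx (if_neg (by simpa using h))
  rw [fourierInt_eq_sum h]
  simp [walk]

theorem fourierInt_walk {a : ℤ} {μ : ℤ → ℝ} (hμ : (Function.support μ).Finite) (n : ℕ) (θ : ℝ) :
    fourierInt (walk a μ n) θ = ∏ j ∈ Finset.range n, fourierInt μ (a ^ j * θ) := by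
  induction n generalizing θ with
  | zero => simpa using fourierInt_walk_zero a μ θ
  | succ n ih =>
    rw [walk, fourierInt_step hμ (support_walk_finite hμ n), ih, Finset.prod_range_succ']
    simp [pow_succ, mul_assoc, mul_comm]

theorem fourierZMod_modq {q : ℕ} [NeZero q] {f : ℤ → ℝ} (hf : (Function.support f).Finite)
    (k : ℤ) : fourierZMod (modq q f) k = fourierInt f (k / q) := by
  obtain ⟨T, hT⟩ : ∃ T : Finset ℤ, Function.support f ⊆ T := ⟨hf.toFinset, by simp⟩
  rw [fourierInt_eq_sum hT, fourierZMod]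
  simp only [modq_eq_sum hT, Complex.ofReal_sum, Finset.sum_mul]
  rw [Finset.sum_comm]
  refine Finset.sum_congr rfl fun y _ => ?_
  rw [Finset.sum_eq_single (y : ZMod q)]
  · rw [if_pos rfl, ← Int.cast_mul, ZMod.stdAddChar_coe]
    congr 2
    push_cast
    ring
  · intro x _ hx
    simp [hx.symm]
  · simp

theorem sum_norm_sq_fourierZMod {q : ℕ} [NeZero q] (g : ZMod q → ℝ) :
    ∑ ξ, ‖fourierZMod g ξ‖ ^ 2 = q * ∑ x, g x ^ 2 := by
  have key : ∑ ξ, (fourierZMod g ξ * (starRingEnd ℂ) (fourierZMod g ξ)) =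
      ((q * ∑ x, g x ^ 2 : ℝ) : ℂ) := by
    have hconj (ξ : ZMod q) : (starRingEnd ℂ) (fourierZMod g ξ) =
        ∑ y, (g y : ℂ) * ZMod.stdAddChar (-(y * ξ)) := by
      simp [fourierZMod, map_sum, AddChar.map_neg_eq_conj]
    simp only [hconj]
    simp only [fourierZMod, Finset.sum_mul_sum]
    rw [Finset.sum_comm]
    push_cast
    rw [Finset.mul_sum]
    refine Finset.sum_congr rfl fun x _ => ?_
    rw [Finset.sum_comm, Finset.sum_eq_single x]
    · have (ξ : ZMod q) : (g x : ℂ) * ZMod.stdAddChar (x * ξ) *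
          (g x * ZMod.stdAddChar (-(x * ξ))) = (g x : ℂ) ^ 2 := by
        have h : (ZMod.stdAddChar (x * ξ) : ℂ) * ZMod.stdAddChar (-(x * ξ)) = 1 := by
          rw [← AddChar.map_add_eq_mul]
          simp
        linear_combination (g x : ℂ) ^ 2 * h
      simp [this]
    · intro y _ hy
      have (ξ : ZMod q) : (g x : ℂ) * ZMod.stdAddChar (x * ξ) *
          (g y * ZMod.stdAddChar (-(y * ξ))) =
          (g x : ℂ) * g y * ZMod.stdAddChar (ξ * (x - y)) := by
        have h : (ZMod.stdAddChar (x * ξ) : ℂ) * ZMod.stdAddChar (-(y * ξ)) =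
            ZMod.stdAddChar (ξ * (x - y)) := by
          rw [← AddChar.map_add_eq_mul]
          congr 1
          ring
        linear_combination (g x : ℂ) * g y * h
      simp only [this, ← Finset.mul_sum]
      rw [AddChar.sum_mulShift _ (ZMod.isPrimitive_stdAddChar q), if_neg (sub_ne_zero.2 hy.symm)]
      simp
    · simp
  have h2 : ∀ ξ, fourierZMod g ξ * (starRingEnd ℂ) (fourierZMod g ξ) =
      ((‖fourierZMod g ξ‖ ^ 2 : ℝ) : ℂ) := fun ξ => by
    rw [Complex.mul_conj, Complex.normSq_eq_norm_sq]
  simp only [h2] at key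
  exact_mod_cast key

theorem sum_norm_sq_fourierZMod_sub_uniform {q : ℕ} [NeZero q] {g : ZMod q → ℝ}
    (hg : fourierZMod g 0 = 1) :
    (q : ℝ) * ∑ x, (g x - 1 / q) ^ 2 =
      ∑ ξ ∈ Finset.univ.erase 0, ‖fourierZMod g ξ‖ ^ 2 := by
  have hsub (ξ : ZMod q) : fourierZMod (fun x => g x - 1 / q) ξ =
      fourierZMod g ξ - if ξ = 0 then 1 else 0 := by
    have h := AddChar.sum_mulShift ξ (ZMod.isPrimitive_stdAddChar q)
    have hq : (q : ℂ) ≠ 0 := NeZero.ne _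
    simp only [fourierZMod, Complex.ofReal_sub, sub_mul, Finset.sum_sub_distrib]
    rw [← Finset.mul_sum, h]
    split_ifs <;> simp [ZMod.card, hq]
  rw [← sum_norm_sq_fourierZMod, ← Finset.add_sum_erase _ _ (Finset.mem_univ 0), hsub, hg]
  simp only [if_true, sub_self, norm_zero]
  rw [zero_pow two_ne_zero, zero_add]
  refine Finset.sum_congr rfl fun ξ hξ => ?_
  rw [hsub, if_neg (Finset.ne_of_mem_erase hξ), sub_zero]

/-! ### The Fourier transform of a good measure -/

theorem fourierInt_zero (f : ℤ → ℝ) : fourierInt f 0 = ((∑' x, f x : ℝ) : ℂ) := by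
  simp [fourierInt, Complex.ofReal_tsum]

theorem norm_exp_two_pi_mul (x θ : ℝ) :
    ‖Complex.exp (2 * Real.pi * Complex.I * x * θ)‖ = 1 := by
  have := Complex.norm_exp_ofReal_mul_I (2 * Real.pi * x * θ)
  rw [← this]
  congr 2
  push_cast
  ring

theorem IsGoodMeasure.sum_eq_one {μ : ℤ → ℝ} (hμ : IsGoodMeasure μ) :
    ∑ y ∈ hμ.finsupp.toFinset, μ y = 1 := by
  rw [← hμ.total, tsum_eq_sum]
  intro y hy
  simpa using hy

theorem IsGoodMeasure.norm_fourierInt_le_one {μ : ℤ → ℝ} (hμ : IsGoodMeasure μ) (θ : ℝ) :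
    ‖fourierInt μ θ‖ ≤ 1 := by
  rw [fourierInt_eq_sum (T := hμ.finsupp.toFinset) (by simp), ← hμ.sum_eq_one]
  refine (norm_sum_le _ _).trans (Finset.sum_le_sum fun y _ => ?_)
  have h := norm_exp_two_pi_mul y θ
  rw [Complex.ofReal_intCast] at h
  rw [norm_mul, h, mul_one, Complex.norm_real, Real.norm_of_nonneg (hμ.nonneg y)]

theorem IsGoodMeasure.norm_fourierInt_lt_one {μ : ℤ → ℝ} (hμ : IsGoodMeasure μ) {θ : ℝ}
    (hθ : ∀ k : ℤ, θ ≠ k) : ‖fourierInt μ θ‖ < 1 := by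
  refine (hμ.norm_fourierInt_le_one θ).lt_of_ne fun h1 => ?_
  set z := fourierInt μ θ
  have hzz : (starRingEnd ℂ) z * z = 1 := by
    rw [mul_comm, Complex.mul_conj, Complex.normSq_eq_norm_sq, h1]
    simp
  set T := hμ.finsupp.toFinset
  have hzT : z = ∑ y ∈ T, (μ y : ℂ) * Complex.exp (2 * Real.pi * Complex.I * y * θ) :=
    fourierInt_eq_sum (by simp [T]) θ
  let w : ℤ → ℂ := fun y =>
    (starRingEnd ℂ) z * Complex.exp (2 * Real.pi * Complex.I * y * θ)
  have hw (y : ℤ) : ‖w y‖ = 1 := by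
    have h := norm_exp_two_pi_mul y θ
    rw [Complex.ofReal_intCast] at h
    simp [w, h, h1]
  have hwre (y : ℤ) : (w y).re ≤ 1 := (Complex.re_le_norm _).trans (hw y).le
  have hsum : ∑ y ∈ T, μ y * (1 - (w y).re) = 0 := by
    have h : ∑ y ∈ T, (μ y : ℂ) * w y = 1 := by
      rw [← hzz]
      nth_rewrite 2 [hzT]
      rw [Finset.mul_sum]
      refine Finset.sum_congr rfl fun y _ => ?_
      simp only [w]
      ring
    have h' : ∑ y ∈ T, μ y * (w y).re = 1 := by
      simpa using congrArg Complex.re h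
    simp only [mul_sub, mul_one, Finset.sum_sub_distrib, h']
    rw [hμ.sum_eq_one, sub_self]
  have hw1 (y : ℤ) (hy : y ∈ Function.support μ) : w y = 1 := by
    have h := (Finset.sum_eq_zero_iff_of_nonneg fun y _ =>
      mul_nonneg (hμ.nonneg y) (sub_nonneg.2 (hwre y))).1 hsum y (by simpa [T] using hy)
    have hre : (w y).re = 1 := by
      rcases mul_eq_zero.1 h with h | h
      · exact absurd h hy
      · linarith
    have him : (w y).im = 0 := by
      have := Complex.sq_norm (w y)
      rw [hw, Complex.normSq_apply, hre] at this
      nlinarith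
    exact Complex.ext hre him
  have hexp (x y : ℤ) (hx : x ∈ Function.support μ) (hy : y ∈ Function.support μ) :
      ∃ k : ℤ, ((x - y : ℤ) : ℝ) * θ = k := by
    have hz0 : (starRingEnd ℂ) z ≠ 0 := left_ne_zero_of_mul_eq_one hzz
    have h := mul_left_cancel₀ hz0 ((hw1 x hx).trans (hw1 y hy).symm)
    obtain ⟨k, hk⟩ := Complex.exp_eq_exp_iff_exists_int.1 h
    refine ⟨k, ?_⟩
    have hpi : (2 * Real.pi * Complex.I : ℂ) ≠ 0 := Complex.two_pi_I_ne_zero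
    have h2 : ((x - y : ℤ) : ℂ) * θ = k := by
      apply mul_left_cancel₀ hpi
      push_cast
      linear_combination hk
    exact_mod_cast h2
  let H : AddSubgroup ℤ :=
    { carrier := {d | ∃ k : ℤ, (d : ℝ) * θ = k}
      zero_mem' := ⟨0, by simp⟩
      add_mem' := by
        rintro x y ⟨k, hk⟩ ⟨l, hl⟩
        exact ⟨k + l, by push_cast; rw [add_mul, hk, hl]⟩
      neg_mem' := by
        rintro x ⟨k, hk⟩
        exact ⟨-k, by push_cast; rw [neg_mul, hk]⟩ }
  obtain ⟨d, hd⟩ := Int.subgroup_cyclic H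
  rw [← AddSubgroup.zmultiples_eq_closure] at hd
  have hmem (x : ℤ) : (∃ k : ℤ, (x : ℝ) * θ = k) ↔ d ∣ x := by
    rw [← Int.mem_zmultiples_iff, ← hd]
    rfl
  have hunit : IsUnit d := hμ.gcd_one d fun x hx y hy => (hmem _).1 (hexp x y hx hy)
  obtain ⟨k, hk⟩ := (hmem 1).2 hunit.dvd
  exact hθ k (by simpa using hk)

theorem IsGoodMeasure.exists_norm_fourierInt_sq_le {μ : ℤ → ℝ} (hμ : IsGoodMeasure μ) {δ : ℝ}
    (hδ : 0 < δ) (hδ' : δ ≤ 1 / 2) :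
    ∃ ρ : ℝ, 0 < ρ ∧ ρ < 1 ∧ ∀ θ : ℝ, δ ≤ |θ| → |θ| ≤ 1 / 2 → ‖fourierInt μ θ‖ ^ 2 ≤ ρ := by
  have hcont : Continuous fun θ => ‖fourierInt μ θ‖ ^ 2 := by
    simp only [fourierInt_eq_sum (T := hμ.finsupp.toFinset) (f := μ) (by simp)]
    fun_prop
  have hK : IsCompact (Set.Icc (-(1 / 2) : ℝ) (1 / 2) ∩ {θ | δ ≤ |θ|}) :=
    isCompact_Icc.inter_right (isClosed_le continuous_const continuous_abs)
  obtain ⟨t, ⟨ht, htδ⟩, hmax⟩ := hK.exists_isMaxOn ⟨1 / 2, by norm_num, by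
    rw [Set.mem_ofPred_eq, abs_of_pos (by norm_num)]; exact hδ'⟩ hcont.continuousOn
  have htlt : ‖fourierInt μ t‖ < 1 := by
    refine hμ.norm_fourierInt_lt_one fun k hk => ?_
    have h1 : |(k : ℝ)| < 1 := by
      rw [← hk]
      linarith [abs_le.2 ht]
    have h2 : |k| < 1 := by exact_mod_cast h1
    have hk0 : k = 0 := Int.abs_lt_one_iff.1 h2
    have htδ : δ ≤ |t| := htδ
    rw [hk, hk0] at htδ
    simp at htδ
    linarith
  refine ⟨max (1 / 2) (‖fourierInt μ t‖ ^ 2), by positivity, max_lt (by norm_num)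
    (pow_lt_one₀ (norm_nonneg _) htlt two_ne_zero), fun θ h1 h2 => ?_⟩
  exact le_max_of_le_right (hmax ⟨abs_le.1 h2, h1⟩)

/-! ### Carries in multiplication by `a` modulo `q` -/

/-- The carry when the balanced representative of `x` is multiplied by `a` and reduced. -/
noncomputable def carry {q : ℕ} (a : ℤ) (x : ZMod q) : ℤ :=
  (a * x.valMinAbs - ((a : ZMod q) * x).valMinAbs) / q

theorem mul_carry {q : ℕ} (a : ℤ) (x : ZMod q) :
    q * carry a x = a * x.valMinAbs - ((a : ZMod q) * x).valMinAbs := by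
  refine Int.mul_ediv_cancel' ?_
  rw [← ZMod.intCast_zmod_eq_zero_iff_dvd]
  simp

theorem carry_zero {q : ℕ} (a : ℤ) : carry a (0 : ZMod q) = 0 := by
  simp [carry]

theorem two_mul_abs_valMinAbs_le {q : ℕ} [NeZero q] (x : ZMod q) : 2 * |x.valMinAbs| ≤ q := by
  have h := x.natAbs_valMinAbs_le
  rw [Int.abs_eq_natAbs]
  omega

theorem abs_carry_le {q : ℕ} [NeZero q] {a : ℤ} (ha : 1 < a) (x : ZMod q) :
    |carry a x| ≤ a := by
  have hq : (0 : ℤ) < q := by exact_mod_cast NeZero.pos q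
  have h := mul_carry a x
  have h1 := two_mul_abs_valMinAbs_le x
  have h2 := two_mul_abs_valMinAbs_le ((a : ZMod q) * x)
  have h3 : |(q : ℤ) * carry a x| ≤ a * |x.valMinAbs| + |((a : ZMod q) * x).valMinAbs| := by
    rw [h]
    refine (abs_sub _ _).trans ?_
    rw [abs_mul, abs_of_pos (zero_lt_one.trans ha)]
  rw [abs_mul, abs_of_pos hq] at h3
  refine le_of_mul_le_mul_left ?_ hq
  nlinarith

theorem le_abs_valMinAbs_of_carry_ne_zero {q : ℕ} [NeZero q] {a : ℤ} (ha : 1 < a) {x : ZMod q}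
    (hx : carry a x ≠ 0) : (q : ℤ) ≤ 2 * a * |x.valMinAbs| := by
  have hq : (0 : ℤ) < q := by exact_mod_cast NeZero.pos q
  have h := mul_carry a x
  have h2 := two_mul_abs_valMinAbs_le ((a : ZMod q) * x)
  have h3 : |(q : ℤ) * carry a x| ≤ a * |x.valMinAbs| + |((a : ZMod q) * x).valMinAbs| := by
    rw [h]
    refine (abs_sub _ _).trans ?_
    rw [abs_mul, abs_of_pos (zero_lt_one.trans ha)]
  rw [abs_mul, abs_of_pos hq] at h3
  have h4 : 1 ≤ |carry a x| := Int.one_le_abs hx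
  nlinarith

theorem eq_of_carry_eq {q : ℕ} [NeZero q] {a : ℤ} {m : ℕ} (hm : (q : ℤ) < a ^ m)
    (ha : 1 < a) {x y : ZMod q}
    (h : ∀ j < m, carry a ((a : ZMod q) ^ j * x) = carry a ((a : ZMod q) ^ j * y)) : x = y := by
  have key : ∀ j ≤ m, ((a : ZMod q) ^ j * x).valMinAbs - ((a : ZMod q) ^ j * y).valMinAbs =
      a ^ j * (x.valMinAbs - y.valMinAbs) := by
    intro j
    induction j with
    | zero => simp
    | succ j ih =>
      intro hj
      have hx := mul_carry a ((a : ZMod q) ^ j * x)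
      have hy := mul_carry a ((a : ZMod q) ^ j * y)
      rw [h j hj] at hx
      rw [pow_succ', mul_assoc, mul_assoc, pow_succ']
      linear_combination a * ih (by omega) + hx - hy
  have hk := key m le_rfl
  have h1 := two_mul_abs_valMinAbs_le ((a : ZMod q) ^ m * x)
  have h2 := two_mul_abs_valMinAbs_le ((a : ZMod q) ^ m * y)
  have h3 := abs_sub ((a : ZMod q) ^ m * x).valMinAbs ((a : ZMod q) ^ m * y).valMinAbs
  have hpos : 0 < a ^ m := by positivity
  rw [hk, abs_mul, abs_of_pos hpos] at h3
  have h4 : |x.valMinAbs - y.valMinAbs| < 1 := by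
    by_contra! h5
    nlinarith
  rw [Int.abs_lt_one_iff, sub_eq_zero] at h4
  exact ZMod.injective_valMinAbs h4

theorem sum_prod_le_of_carry {q : ℕ} [NeZero q] {a : ℤ} (ha : 1 < a) {m : ℕ}
    (hm : (q : ℤ) < a ^ m) {G : ZMod q → ℝ} {ε : ℝ} (hε : 0 ≤ ε) (hG0 : ∀ x, 0 ≤ G x)
    (hG1 : ∀ x, G x ≤ 1) (hGε : ∀ x, (q : ℤ) ≤ 2 * a * |x.valMinAbs| → G x ≤ ε) :
    ∑ ξ ∈ Finset.univ.erase 0, ∏ j ∈ Finset.range m, G ((a : ZMod q) ^ j * ξ) ≤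
      (1 + 2 * a * ε) ^ m - 1 := by
  let w : ℤ → ℝ := fun c => if c = 0 then 1 else ε
  have hw0 (c : ℤ) : 0 ≤ w c := by
    simp only [w]
    split_ifs <;> linarith
  let Φ : ZMod q → Fin m → ℤ := fun ξ j => carry a ((a : ZMod q) ^ (j : ℕ) * ξ)
  have hΦ : Function.Injective Φ := fun x y h =>
    eq_of_carry_eq hm ha fun j hj => congrFun h ⟨j, hj⟩
  have hΦ0 : Φ 0 = 0 := by
    ext j
    simp [Φ, carry_zero]
  have hGw (x : ZMod q) : G x ≤ w (carry a x) := by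
    simp only [w]
    split_ifs with h
    · exact hG1 x
    · exact hGε x (le_abs_valMinAbs_of_carry_ne_zero ha h)
  let S : Finset (Fin m → ℤ) := Fintype.piFinset fun _ => Finset.Icc (-a) a
  have hS0 : (0 : Fin m → ℤ) ∈ S := by
    simp only [S, Fintype.mem_piFinset, Finset.mem_Icc, Pi.zero_apply]
    intro
    constructor <;> linarith
  have hwsum : ∑ c ∈ Finset.Icc (-a) a, w c = 1 + 2 * a * ε := by
    have h0 : (0 : ℤ) ∈ Finset.Icc (-a) a := by
      rw [Finset.mem_Icc]
      constructor <;> linarith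
    rw [← Finset.add_sum_erase _ _ h0, Finset.sum_congr rfl fun c hc =>
      (if_neg (Finset.ne_of_mem_erase hc) : w c = ε), Finset.sum_const, Finset.card_erase_of_mem h0,
      Int.card_Icc, nsmul_eq_mul]
    have : (((a + 1 - -a).toNat - 1 : ℕ) : ℤ) = 2 * a := by omega
    have : (((a + 1 - -a).toNat - 1 : ℕ) : ℝ) = 2 * a := by exact_mod_cast this
    rw [this]
    simp [w]
  calc ∑ ξ ∈ Finset.univ.erase 0, ∏ j ∈ Finset.range m, G ((a : ZMod q) ^ j * ξ)
      ≤ ∑ ξ ∈ Finset.univ.erase 0, ∏ j, w (Φ ξ j) := by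
        refine Finset.sum_le_sum fun ξ _ => ?_
        rw [Finset.prod_range]
        exact Finset.prod_le_prod (fun _ _ => hG0 _) fun _ _ => hGw _
    _ = ∑ c ∈ (Finset.univ.erase 0).image Φ, ∏ j, w (c j) := by
        rw [Finset.sum_image hΦ.injOn]
    _ ≤ ∑ c ∈ S.erase 0, ∏ j, w (c j) := by
        refine Finset.sum_le_sum_of_subset_of_nonneg (fun c hc => ?_) fun c _ _ =>
          Finset.prod_nonneg fun _ _ => hw0 _
        obtain ⟨ξ, hξ, rfl⟩ := Finset.mem_image.1 hc
        refine Finset.mem_erase.2 ⟨fun h => Finset.ne_of_mem_erase hξ (hΦ (h.trans hΦ0.symm)), ?_⟩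
        simp only [S, Fintype.mem_piFinset, Finset.mem_Icc]
        exact fun j => abs_le.1 (abs_carry_le ha _)
    _ = (1 + 2 * a * ε) ^ m - 1 := by
        have h := Finset.add_sum_erase S (fun c => ∏ j, w (c j)) hS0
        have hprod : ∑ c ∈ S, ∏ j, w (c j) = (1 + 2 * a * ε) ^ m := by
          simp only [S]
          rw [← Finset.prod_univ_sum, hwsum]
          simp
        rw [hprod] at h
        have h1 : ∏ j : Fin m, w ((0 : Fin m → ℤ) j) = 1 := by simp [w]
        rw [h1] at h
        linarith

/-! ### Splitting into blocks -/

theorem prod_range_mul_eq {M : Type*} [CommMonoid M] (f : ℕ → M) (r m : ℕ) :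
    ∏ i ∈ Finset.range (r * m), f i =
      ∏ k ∈ Finset.range r, ∏ j ∈ Finset.range m, f (k * m + j) := by
  induction r with
  | zero => simp
  | succ r ih => rw [Nat.succ_mul, Finset.prod_range_add, ih, Finset.prod_range_succ]

theorem prod_le_sum_pow_div {r : ℕ} (hr : 0 < r) (z : ℕ → ℝ) (hz : ∀ k, 0 ≤ z k) :
    ∏ k ∈ Finset.range r, z k ≤ ∑ k ∈ Finset.range r, (1 / r : ℝ) * z k ^ r := by
  have hr' : (r : ℝ) ≠ 0 := by positivity
  have h := Real.geom_mean_le_arith_mean_weighted (Finset.range r) (fun _ => (1 / r : ℝ))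
    (fun k => z k ^ r) (fun _ _ => by positivity) (by simp [hr']) (fun k _ => pow_nonneg (hz k) r)
  refine le_trans (le_of_eq (Finset.prod_congr rfl fun k _ => ?_)) h
  rw [one_div, Real.pow_rpow_inv_natCast (hz k) hr.ne']

theorem sum_prod_le_sum_pow {q : ℕ} [NeZero q] {a : ℤ} (hqa : Int.gcd (q : ℤ) a = 1)
    {G : ZMod q → ℝ} (hG0 : ∀ x, 0 ≤ G x) (hG1 : ∀ x, G x ≤ 1) {n m r : ℕ} (hr : 0 < r)
    (hn : r * m ≤ n) :
    ∑ ξ ∈ Finset.univ.erase 0, ∏ j ∈ Finset.range n, G ((a : ZMod q) ^ j * ξ) ≤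
      ∑ ξ ∈ Finset.univ.erase 0, ∏ j ∈ Finset.range m, G ((a : ZMod q) ^ j * ξ) ^ r := by
  have hr' : (r : ℝ) ≠ 0 := by positivity
  have hunit : IsUnit (a : ZMod q) := by
    obtain ⟨u, v, huv⟩ := Int.isCoprime_iff_gcd_eq_one.2 hqa
    refine .of_mul_eq_one (v : ZMod q) ?_
    have h := congrArg (Int.cast : ℤ → ZMod q) huv
    push_cast at h
    rw [ZMod.natCast_self, mul_zero, zero_add] at h
    rw [mul_comm, h]
  let F : ZMod q → ℝ := fun ξ => ∏ j ∈ Finset.range m, G ((a : ZMod q) ^ j * ξ)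
  have hF0 (ξ : ZMod q) : 0 ≤ F ξ := Finset.prod_nonneg fun _ _ => hG0 _
  have hshift (k : ℕ) : ∑ ξ ∈ Finset.univ.erase 0, F ((a : ZMod q) ^ k * ξ) ^ r =
      ∑ ξ ∈ Finset.univ.erase 0, F ξ ^ r := by
    obtain ⟨u, hu⟩ := hunit.pow k
    rw [← hu]
    refine Finset.sum_equiv (Units.mulLeft u) (fun ξ => ?_) fun ξ _ => rfl
    simp
  calc ∑ ξ ∈ Finset.univ.erase 0, ∏ j ∈ Finset.range n, G ((a : ZMod q) ^ j * ξ)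
      ≤ ∑ ξ ∈ Finset.univ.erase 0, ∏ k ∈ Finset.range r, F ((a : ZMod q) ^ (k * m) * ξ) := by
        refine Finset.sum_le_sum fun ξ _ => ?_
        obtain ⟨d, rfl⟩ := Nat.exists_eq_add_of_le hn
        rw [Finset.prod_range_add, prod_range_mul_eq]
        refine (mul_le_of_le_one_right (Finset.prod_nonneg fun _ _ =>
          Finset.prod_nonneg fun _ _ => hG0 _)
          (Finset.prod_le_one (fun _ _ => hG0 _) fun _ _ => hG1 _)).trans_eq ?_
        refine Finset.prod_congr rfl fun k _ => Finset.prod_congr rfl fun j _ => ?_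
        rw [← mul_assoc, ← pow_add, add_comm]
    _ ≤ ∑ ξ ∈ Finset.univ.erase 0,
          ∑ k ∈ Finset.range r, (1 / r : ℝ) * F ((a : ZMod q) ^ (k * m) * ξ) ^ r :=
        Finset.sum_le_sum fun ξ _ => prod_le_sum_pow_div hr _ fun _ => hF0 _
    _ = ∑ ξ ∈ Finset.univ.erase 0, F ξ ^ r := by
        rw [Finset.sum_comm]
        simp only [← Finset.mul_sum, hshift]
        rw [Finset.sum_const, Finset.card_range, nsmul_eq_mul, ← mul_assoc,
          one_div_mul_cancel hr', one_mul]
    _ = _ := by simp only [F, Finset.prod_pow]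

theorem one_add_pow_sub_one_le {t : ℝ} (ht : 0 ≤ t) {m : ℕ} (hmt : m * t ≤ 1) :
    (1 + t) ^ m - 1 ≤ 2 * (m * t) := by
  have h1 : (1 + t) ^ m ≤ Real.exp (m * t) := by
    rw [Real.exp_nat_mul]
    exact pow_le_pow_left₀ (by linarith) (by linarith [Real.add_one_le_exp t]) m
  have h2 := Real.abs_exp_sub_one_le (x := m * t) (by rwa [abs_of_nonneg (by positivity)])
  rw [abs_of_nonneg (by positivity : 0 ≤ m * t)] at h2
  linarith [le_abs_self (Real.exp (m * t) - 1)]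

theorem mul_sum_sq_modq_walk_le {a : ℤ} (ha : 1 < a) {μ : ℤ → ℝ} (hμ : IsGoodMeasure μ) :
    ∃ ρ : ℝ, 0 < ρ ∧ ρ < 1 ∧ ∀ q : ℕ, 0 < q → Int.gcd (q : ℤ) a = 1 →
      ∀ n m r : ℕ, (q : ℤ) < a ^ m → 0 < r → r * m ≤ n → m * (2 * a * ρ ^ r) ≤ 1 →
        (q : ℝ) * (∑' x : ZMod q, (modq q (walk a μ n) x - 1 / q) ^ 2) ≤
          2 * (m * (2 * a * ρ ^ r)) := by
  have haR : (1 : ℝ) < a := by exact_mod_cast ha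
  obtain ⟨ρ, hρ0, hρ1, hρ⟩ := hμ.exists_norm_fourierInt_sq_le (δ := 1 / (2 * a)) (by positivity)
    (one_div_le_one_div_of_le two_pos (by linarith))
  refine ⟨ρ, hρ0, hρ1, fun q hq hqa n m r hqm hr hrn hsmall => ?_⟩
  have : NeZero q := ⟨hq.ne'⟩
  have hqR : (0 : ℝ) < q := by exact_mod_cast hq
  have hwalk := support_walk_finite (a := a) hμ.finsupp n
  let G : ZMod q → ℝ := fun x => ‖fourierZMod (modq q μ) x‖ ^ 2
  have hGint (k : ℤ) : G k = ‖fourierInt μ (k / q)‖ ^ 2 := by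
    simp only [G, fourierZMod_modq hμ.finsupp]
  have hGval (x : ZMod q) : G x = ‖fourierInt μ (x.valMinAbs / q)‖ ^ 2 := by
    rw [← hGint, ZMod.coe_valMinAbs]
  have hG0 (x : ZMod q) : 0 ≤ G x := by positivity
  have hG1 (x : ZMod q) : G x ≤ 1 := by
    rw [hGval]
    exact pow_le_one₀ (norm_nonneg _) (hμ.norm_fourierInt_le_one _)
  have hGρ (x : ZMod q) (hx : (q : ℤ) ≤ 2 * a * |x.valMinAbs|) : G x ≤ ρ := by
    rw [hGval]
    have hx' : (q : ℝ) ≤ 2 * a * |(x.valMinAbs : ℝ)| := by exact_mod_cast hx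
    have h2 : 2 * |(x.valMinAbs : ℝ)| ≤ q := by exact_mod_cast two_mul_abs_valMinAbs_le x
    refine hρ _ ?_ ?_
    · rw [abs_div, abs_of_pos hqR, div_le_div_iff₀ (by positivity) hqR]
      linarith
    · rw [abs_div, abs_of_pos hqR, div_le_div_iff₀ hqR two_pos]
      linarith
  have hFwalk (ξ : ZMod q) : ‖fourierZMod (modq q (walk a μ n)) ξ‖ ^ 2 =
      ∏ j ∈ Finset.range n, G ((a : ZMod q) ^ j * ξ) := by
    rw [← ZMod.coe_valMinAbs ξ, fourierZMod_modq hwalk, fourierInt_walk hμ.finsupp, norm_prod,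
      ← Finset.prod_pow]
    refine Finset.prod_congr rfl fun j _ => ?_
    have h := hGint (a ^ j * ξ.valMinAbs)
    push_cast at h
    rw [ZMod.coe_valMinAbs, h, mul_div_assoc]
  have hzero : fourierZMod (modq q (walk a μ n)) 0 = 1 := by
    have h := fourierZMod_modq (q := q) hwalk 0
    rw [fourierInt_walk hμ.finsupp] at h
    simpa [fourierInt_zero, hμ.total] using h
  rw [tsum_fintype, sum_norm_sq_fourierZMod_sub_uniform hzero]
  simp only [hFwalk]
  refine (sum_prod_le_sum_pow hqa hG0 hG1 hr hrn).trans ?_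
  refine (sum_prod_le_of_carry ha hqm (G := fun x => G x ^ r) (ε := ρ ^ r) (by positivity)
    (fun x => pow_nonneg (hG0 x) r) (fun x => pow_le_one₀ (hG0 x) (hG1 x))
    fun x hx => pow_le_pow_left₀ (hG0 x) (hGρ x hx) r).trans ?_
  exact one_add_pow_sub_one_le (by positivity) hsmall

/-- small moduli: there are `C, c > 0` depending only on `a` and `μ` such
that for every `q ≥ 3` with `gcd(q, a) = 1` and every `n > C·log q·log log q`:
`q·‖μ_n mod q − u_q‖₂² ≤ e^{−c·n/log q}`. -/
theorem stmt9 (a : ℤ) (ha : 1 < a) (μ : ℤ → ℝ) (hμ : IsGoodMeasure μ) :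
    ∃ C c : ℝ, 0 < C ∧ 0 < c ∧
      ∀ q : ℕ, 3 ≤ q → Int.gcd (q : ℤ) a = 1 →
        ∀ n : ℕ, C * Real.log q * Real.log (Real.log q) < n →
          (q : ℝ) * (∑' x : ZMod q, (modq q (walk a μ n) x - 1 / q) ^ 2)
            ≤ Real.exp (-c * n / Real.log q) := by
  obtain ⟨ρ, hρ0, hρ1, hρ⟩ := mul_sum_sq_modq_walk_le ha hμ
  have haR : (1 : ℝ) < a := by exact_mod_cast ha
  set κ := -Real.log ρ with hκ
  have hκ0 : 0 < κ := neg_pos.2 (Real.log_neg hρ0 hρ1)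
  have hlog3 : 1 < Real.log 3 := by
    rw [Real.lt_log_iff_exp_lt (by norm_num)]
    linarith [Real.exp_one_lt_d9]
  set l := Real.log (Real.log 3)
  have hl : 0 < l := Real.log_pos hlog3
  have hB : 0 < Real.log (12 * a) + κ := by
    have := Real.log_pos (by linarith : (1 : ℝ) < 12 * a)
    linarith
  refine ⟨6 * ((Real.log (12 * a) + κ) / l + 1) / κ, κ / 6, by positivity, by positivity,
    fun q hq hqa n hn => ?_⟩
  have hqR : (3 : ℝ) ≤ q := by exact_mod_cast hq
  set L := Real.log q
  have hL3 : Real.log 3 ≤ L := Real.log_le_log (by norm_num) hqR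
  have hL1 : 1 < L := hlog3.trans_le hL3
  have hL0 : 0 < L := by linarith
  have hlL : l ≤ Real.log L := Real.log_le_log (by linarith) hL3
  set m := Nat.log 2 q + 1 with hm
  have hqm : (q : ℤ) < a ^ m := by
    have h1 : q < 2 ^ m := Nat.lt_pow_succ_log_self one_lt_two q
    have h2 : (q : ℤ) < 2 ^ m := by exact_mod_cast h1
    exact h2.trans_le (pow_le_pow_left₀ (by norm_num) (by omega) m)
  have hmL : (m : ℝ) ≤ 3 * L := by
    have h1 : 2 ^ Nat.log 2 q ≤ q := Nat.pow_log_le_self 2 (by omega)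
    have h2 : (2 : ℝ) ^ Nat.log 2 q ≤ q := by exact_mod_cast h1
    have h3 := Real.log_le_log (by positivity) h2
    rw [Real.log_pow] at h3
    have h4 : (0 : ℝ) ≤ Nat.log 2 q := Nat.cast_nonneg _
    have h5 := Real.log_two_gt_d9
    rw [hm]
    push_cast
    nlinarith
  have hm1 : (1 : ℝ) ≤ m := by
    rw [hm]
    push_cast
    linarith [(Nat.cast_nonneg (Nat.log 2 q) : (0 : ℝ) ≤ _)]
  set r := n / m
  have hrn : r * m ≤ n := Nat.div_mul_le_self n m
  have hnr : (n : ℝ) / (3 * L) ≤ r + 1 := by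
    have h1 : n < m * (r + 1) := Nat.lt_mul_div_succ n (by omega)
    have h2 : (n : ℝ) < m * (r + 1) := by exact_mod_cast h1
    rw [div_le_iff₀ (by positivity)]
    have h3 : (m : ℝ) * (r + 1) ≤ 3 * L * (r + 1) := by gcongr
    linarith
  have hnL : Real.log (12 * a) + κ + Real.log L ≤ κ * n / (6 * L) := by
    have h1 : Real.log (12 * a) + κ ≤ (Real.log (12 * a) + κ) / l * Real.log L := by
      rw [div_mul_eq_mul_div, le_div_iff₀ hl]
      gcongr
    rw [le_div_iff₀ (by positivity)]
    have h2 : 6 * ((Real.log (12 * a) + κ) / l + 1) / κ * L * Real.log L * κ ≤ n * κ := by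
      gcongr
    have h3 : 6 * ((Real.log (12 * a) + κ) / l + 1) / κ * L * Real.log L * κ =
        ((Real.log (12 * a) + κ) / l * Real.log L + Real.log L) * (6 * L) := by
      field_simp
    rw [h3] at h2
    refine le_trans ?_ (h2.trans_eq (mul_comm _ _))
    gcongr
  have hρr : ρ ^ r = Real.exp (-κ * r) := by
    rw [hκ, neg_neg, mul_comm, Real.exp_nat_mul, Real.exp_log hρ0]
  have hmain : 2 * (m * (2 * a * ρ ^ r)) ≤ Real.exp (-(κ / 6) * n / L) := by
    calc 2 * (m * (2 * a * ρ ^ r)) ≤ 2 * (3 * L * (2 * a * ρ ^ r)) := by gcongr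
      _ = 12 * a * L * ρ ^ r := by ring
      _ = Real.exp (Real.log (12 * a) + Real.log L - κ * r) := by
        rw [hρr, Real.exp_sub, Real.exp_add, Real.exp_log (by positivity), Real.exp_log hL0,
          neg_mul, Real.exp_neg, div_eq_mul_inv]
      _ ≤ Real.exp (-(κ / 6) * n / L) := by
        refine Real.exp_le_exp.2 ?_
        have h1 := mul_le_mul_of_nonneg_left hnr hκ0.le
        have h2 : κ * (n / (3 * L)) = 2 * (κ * n / (6 * L)) := by
          field_simp
          ring
        have h3 : -(κ / 6) * n / L = -(κ * n / (6 * L)) := by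
          field_simp
        rw [h3]
        linarith
  have hle1 : Real.exp (-(κ / 6) * n / L) ≤ 1 := by
    refine Real.exp_le_one_iff.2 (div_nonpos_of_nonpos_of_nonneg ?_ hL0.le)
    rw [neg_mul, neg_nonpos]
    positivity
  have hr0 : 0 < r := by
    refine Nat.pos_of_ne_zero fun h => ?_
    rw [h, pow_zero] at hmain
    nlinarith
  have hnonneg : 0 ≤ m * (2 * a * ρ ^ r) := by positivity
  exact (hρ q (by omega) hqa n m r hqm hr0 hrn (by linarith)).trans hmain
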